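/- Let α = a/b be a rational number with a, b coprime integers, α ≠ 0 and α ≠ 1. Let p be a prime not dividing a·b·(a−b), let t be the multiplicative order of the image of α in (ℤ/pℤ)*, and assume t is not divisible by 5. Set I = (p−1)/t (the residual index of α modulo p) and ε = (t/5) ∈ {−1, +1} (the Legendre symbol of t modulo 5). Then F_p(α) ≡ Fib(I + ε) (mod p), where Fib denotes the ordinary Fibonacci sequence and the index I + ε is a nonnegative integer. -/

import Mathlib

/-- Schur's `q`-Fibonacci numbers with a rational parameter. -/
def qFibQ (q : ℚ) : ℕ → ℚ
  | 0 => 0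
  | 1 => 1
  | n + 2 => qFibQ q (n + 1) + q ^ n * qFibQ q n

instance : Fact (Nat.Prime 5) := ⟨by norm_num⟩

section Recurrence

variable {R S : Type*} [CommRing R] [CommRing S]

/-- The solution of `u (n + 2) = u (n + 1) + x * q ^ n * u n` with `u 0 = a` and `u 1 = b`. -/
def qRec (q x a b : R) : ℕ → R
  | 0 => a
  | 1 => b
  | n + 2 => qRec q x a b (n + 1) + x * q ^ n * qRec q x a b n

lemma qRec_add_two (q x a b : R) (n : ℕ) :
    qRec q x a b (n + 2) = qRec q x a b (n + 1) + x * q ^ n * qRec q x a b n := by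
  rw [qRec]

lemma qRec_eq_basis (q x a b : R) (n : ℕ) :
    qRec q x a b n = b * qRec q x 0 1 n + a * qRec q x 1 0 n := by
  induction n using Nat.twoStepInduction with
  | zero => simp [qRec]
  | one => simp [qRec]
  | more n h1 h2 =>
    simp only [qRec_add_two]
    rw [h1, h2]
    ring

lemma qRec_shift (q x a b : R) (k n : ℕ) :
    qRec q x a b (n + k) =
      qRec q (x * q ^ k) (qRec q x a b k) (qRec q x a b (k + 1)) n := by
  induction n using Nat.twoStepInduction with
  | zero => simp [qRec]
  | one => simp [qRec, add_comm]
  | more n h1 h2 =>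
    rw [qRec_add_two, ← h1, ← h2, show n + 2 + k = (n + k) + 2 by ring, qRec_add_two,
      show n + k + 1 = n + 1 + k by ring]
    ring

lemma map_qRec (f : R →+* S) (q x a b : R) (n : ℕ) :
    f (qRec q x a b n) = qRec (f q) (f x) (f a) (f b) n := by
  induction n using Nat.twoStepInduction with
  | zero => simp [qRec]
  | one => simp [qRec]
  | more n h1 h2 => simp [qRec_add_two, h1, h2]

lemma qRec_zero_succ (q a b : R) (n : ℕ) : qRec q 0 a b (n + 1) = b := by
  induction n with
  | zero => simp [qRec]
  | succ n ih => rw [qRec_add_two, ih]; ring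

/-- The trace of the monodromy matrix is invariant under `x ↦ q * x` when `q ^ t = 1`. -/
lemma qRec_trace_invariant {q : R} {t : ℕ} (hq : q ^ t = 1) (ht : t ≠ 0) (x : R) :
    qRec q (x * q) 0 1 (t + 1) + qRec q (x * q) 1 0 t =
      qRec q x 0 1 (t + 1) + qRec q x 1 0 t := by
  obtain ⟨s, rfl⟩ := Nat.exists_eq_succ_of_ne_zero ht
  have hF := qRec_shift q x 0 1 1 (s + 1)
  have hG := qRec_shift q x 1 0 1 s
  rw [pow_one, show qRec q x 0 1 1 = 1 from rfl, show qRec q x 0 1 (1 + 1) = 1 by simp [qRec],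
    qRec_eq_basis q (x * q) 1 1] at hF
  rw [pow_one, show qRec q x 1 0 1 = 0 from rfl, show qRec q x 1 0 (1 + 1) = x by simp [qRec],
    qRec_eq_basis q (x * q) 0 x] at hG
  rw [hF, hG, qRec_add_two]
  rw [pow_succ] at hq
  linear_combination x * qRec q (x * q) 0 1 s * hq

lemma qRec_casoratian (q : R) (n : ℕ) :
    qRec q 1 0 1 (n + 1) * qRec q 1 1 0 n - qRec q 1 0 1 n * qRec q 1 1 0 (n + 1) =
      (-1) ^ n * q ^ (n * (n - 1) / 2) := by
  induction n with
  | zero => simp [qRec]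
  | succ n ih =>
    rw [qRec_add_two, qRec_add_two, ← Finset.sum_range_id_mul_two, Nat.mul_div_cancel _ two_pos,
      Finset.sum_range_succ, pow_add, ← Nat.mul_div_cancel (∑ i ∈ Finset.range n, i) two_pos,
      Finset.sum_range_id_mul_two]
    linear_combination (-q ^ n) * ih

end Recurrence

section Trace

open Polynomial

variable {K : Type*} [Field K]

lemma natDegree_qRec_le (q a b : K) (n : ℕ) :
    2 * (qRec (C q) X (C a) (C b) n).natDegree ≤ n := by
  induction n using Nat.twoStepInduction with
  | zero => simp [qRec]
  | one => simp [qRec]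
  | more n h1 h2 =>
    rw [qRec_add_two, ← C_pow]
    have h3 := natDegree_add_le (qRec (C q) X (C a) (C b) (n + 1))
      (X * C (q ^ n) * qRec (C q) X (C a) (C b) n)
    have h4 := natDegree_mul_le (p := X * C (q ^ n)) (q := qRec (C q) X (C a) (C b) n)
    have h5 := natDegree_mul_le (p := (X : K[X])) (q := C (q ^ n))
    simp only [natDegree_X, natDegree_C] at h5
    rcases le_max_iff.mp h3 with h | h <;> omega

lemma qRec_trace_eq_one {q : K} (hq : 2 ≤ orderOf q) :
    qRec q 1 0 1 (orderOf q + 1) + qRec q 1 1 0 (orderOf q) = 1 := by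
  set t := orderOf q with ht
  have hqt : q ^ t = 1 := pow_orderOf_eq_one q
  set T : K[X] := qRec (C q) X (C 0) (C 1) (t + 1) + qRec (C q) X (C 1) (C 0) t with hT
  have hcomp : T.comp (C q * X) = T := by
    have h := qRec_trace_invariant (q := C q) (t := t) (by rw [← C_pow, hqt, C_1])
      (by omega) (X : K[X])
    have hmap (a b : K) (n : ℕ) : (qRec (C q) X (C a) (C b) n).comp (C q * X) =
        qRec (C q) (X * C q) (C a) (C b) n := by
      rw [mul_comm X (C q)]
      simpa using map_qRec (compRingHom (C q * X)) (C q) X (C a) (C b) n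
    rw [hT, add_comp, hmap, hmap]
    simpa only [C_0, C_1] using h
  have hdeg : T.natDegree < t := by
    have h1 := natDegree_qRec_le q 0 1 (t + 1)
    have h2 := natDegree_qRec_le q 1 0 t
    have h3 := natDegree_add_le (qRec (C q) X (C 0) (C 1) (t + 1)) (qRec (C q) X (C 1) (C 0) t)
    rw [← hT] at h3
    rcases le_max_iff.mp h3 with h | h <;> omega
  have hconst : T = C (T.coeff 0) := by
    ext k
    rw [coeff_C]
    split_ifs with hk
    · rw [hk]
    · by_cases hkt : k < t
      · have h := congrArg (fun P => P.coeff k) hcomp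
        simp only [comp_C_mul_X_coeff] at h
        have hne : q ^ k ≠ 1 := fun h1 => absurd (orderOf_dvd_of_pow_eq_one h1)
          (Nat.not_dvd_of_pos_of_lt (by omega) hkt)
        have h' : T.coeff k * (q ^ k - 1) = 0 := by linear_combination h
        exact (mul_eq_zero.mp h').resolve_right (sub_ne_zero.mpr hne)
      · exact coeff_eq_zero_of_natDegree_lt (by omega)
  have heval (x : K) : T.eval x = qRec q x 0 1 (t + 1) + qRec q x 1 0 t := by
    rw [hT, eval_add, ← coe_evalRingHom, map_qRec, map_qRec]
    simp
  rw [← heval 1, hconst, eval_C, coeff_zero_eq_eval_zero, heval, qRec_zero_succ]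
  obtain ⟨s, hs⟩ : ∃ s, t = s + 1 := ⟨t - 1, by omega⟩
  rw [hs, qRec_zero_succ, add_zero]

end Trace

section Schur

variable {K : Type*} [Field K]

/-- Gaussian binomial coefficients with an integer lower index. -/
def gaussBinom (q : K) : ℕ → ℤ → K
  | 0, k => if k = 0 then 1 else 0
  | n + 1, k => q ^ k * gaussBinom q n k + gaussBinom q n (k - 1)

lemma gaussBinom_succ (q : K) (n : ℕ) (k : ℤ) :
    gaussBinom q (n + 1) k = q ^ k * gaussBinom q n k + gaussBinom q n (k - 1) := by
  rw [gaussBinom]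

lemma gaussBinom_of_neg (q : K) (n : ℕ) {k : ℤ} (hk : k < 0) : gaussBinom q n k = 0 := by
  induction n generalizing k with
  | zero => simp [gaussBinom, hk.ne]
  | succ n ih => rw [gaussBinom_succ, ih hk, ih (by omega)]; ring

lemma gaussBinom_of_lt (q : K) (n : ℕ) {k : ℤ} (hk : n < k) : gaussBinom q n k = 0 := by
  induction n generalizing k with
  | zero => simp [gaussBinom, (show k ≠ 0 by rintro rfl; simp at hk)]
  | succ n ih =>
    push_cast at hk
    rw [gaussBinom_succ, ih (by omega), ih (by omega)]; ring

lemma gaussBinom_zero_right (q : K) (n : ℕ) : gaussBinom q n 0 = 1 := by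
  induction n with
  | zero => simp [gaussBinom]
  | succ n ih => rw [gaussBinom_succ, ih, gaussBinom_of_neg _ _ (by omega)]; simp

lemma gaussBinom_self (q : K) (n : ℕ) : gaussBinom q n n = 1 := by
  induction n with
  | zero => simp [gaussBinom]
  | succ n ih =>
    rw [gaussBinom_succ, gaussBinom_of_lt _ _ (by push_cast; omega)]
    simp [ih]

lemma gaussBinom_succ' {q : K} (hq : q ≠ 0) (n : ℕ) (k : ℤ) :
    gaussBinom q (n + 1) k = gaussBinom q n k + q ^ (n + 1 - k) * gaussBinom q n (k - 1) := by
  induction n generalizing k with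
  | zero =>
    rw [gaussBinom_succ]
    by_cases h0 : k = 0
    · subst h0; simp [gaussBinom]
    · by_cases h1 : k = 1
      · subst h1; simp [gaussBinom]
      · simp [gaussBinom, h0, sub_eq_zero, h1]
  | succ n ih =>
    have h1 := gaussBinom_succ q n k
    have h2 := gaussBinom_succ q n (k - 1)
    have h3 := ih k
    have h4 := ih (k - 1)
    rw [gaussBinom_succ q (n + 1) k]
    have e1 : q ^ k * q ^ ((n : ℤ) + 1 - k) = q ^ ((n : ℤ) + 1) := by
      rw [← zpow_add₀ hq]; congr 1; ring
    have e2 : q ^ (((n + 1 : ℕ) : ℤ) + 1 - k) * q ^ (k - 1) = q ^ ((n : ℤ) + 1) := by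
      rw [← zpow_add₀ hq]; congr 1; push_cast; ring
    have e3 : ((n : ℤ) + 1 - (k - 1)) = ((n + 1 : ℕ) : ℤ) + 1 - k := by push_cast; ring
    rw [e3] at h4
    linear_combination q ^ k * h3 - h1 + h4 - q ^ (((n + 1 : ℕ) : ℤ) + 1 - k) * h2 +
      gaussBinom q n (k - 1) * e1 - gaussBinom q n (k - 1) * e2

lemma gaussBinom_orderOf {q : K} (hq : q ≠ 0) {k : ℤ} (h0 : k ≠ 0) (hk : k ≠ orderOf q)
    (ht : orderOf q ≠ 0) : gaussBinom q (orderOf q) k = 0 := by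
  rcases lt_or_gt_of_ne h0 with h | h
  · exact gaussBinom_of_neg _ _ h
  rcases lt_or_gt_of_ne hk with h' | h'
  swap
  · exact gaussBinom_of_lt _ _ h'
  lift k to ℕ using h.le
  obtain ⟨s, hs⟩ := Nat.exists_eq_succ_of_ne_zero ht
  have hne : q ^ k ≠ 1 := fun h1 => absurd (orderOf_dvd_of_pow_eq_one h1)
    (Nat.not_dvd_of_pos_of_lt (by omega) (by omega))
  have h1 := gaussBinom_succ q s k
  have h2 := gaussBinom_succ' hq s k
  have e : q ^ (k : ℤ) * q ^ ((s : ℤ) + 1 - k) = 1 := by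
    rw [← zpow_add₀ hq, show (k : ℤ) + (s + 1 - k) = ((s + 1 : ℕ) : ℤ) by push_cast; ring,
      zpow_natCast, ← Nat.succ_eq_add_one, ← hs, pow_orderOf_eq_one]
  rw [hs]
  rw [zpow_natCast] at h1 e
  have h3 : (q ^ k - 1) * gaussBinom q (s + 1) k = 0 := by
    linear_combination q ^ k * h2 - h1 + gaussBinom q s (k - 1) * e
  exact (mul_eq_zero.mp h3).resolve_left (sub_ne_zero.mpr hne)

/-- The summand of Schur's finite form of the first Rogers-Ramanujan identity. -/
def schurTerm (q : K) (n : ℕ) (j : ℤ) : K :=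
  (-1) ^ j * q ^ (j * (5 * j + 1) / 2) * gaussBinom q n ((n - 5 * j) / 2)

/-- The telescoping certificate for the recurrence satisfied by the sums of `schurTerm`. -/
def schurCert (q : K) (n : ℕ) (j : ℤ) : K :=
  if 2 ∣ (n : ℤ) + 1 - 5 * j then
    (-1) ^ j * q ^ (j * (5 * j + 1) / 2) * (q ^ ((n : ℤ) + 2 - (n + 1 - 5 * j) / 2) *
      gaussBinom q n ((n + 1 - 5 * j) / 2 - 2))
  else 0

lemma schurTerm_recurrence {q : K} (hq : q ≠ 0) (n : ℕ) (j : ℤ) :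
    schurTerm q (n + 2) j - schurTerm q (n + 1) j - q ^ n * q * schurTerm q n j =
      schurCert q n j - schurCert q n (j - 1) := by
  rcases Int.even_or_odd' ((n : ℤ) + 1 - 5 * j) with ⟨k, hk | hk⟩
  · have hc : schurCert q n (j - 1) = 0 := if_neg (by omega)
    have hd : schurCert q n j = _ := if_pos (by omega)
    rw [hc, hd]
    simp only [schurTerm]
    rw [show (((n + 2 : ℕ) : ℤ) - 5 * j) / 2 = k by push_cast; omega,
      show (((n + 1 : ℕ) : ℤ) - 5 * j) / 2 = k by push_cast; omega,
      show ((n : ℤ) - 5 * j) / 2 = k - 1 by omega,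
      show ((n : ℤ) + 1 - 5 * j) / 2 = k by omega,
      gaussBinom_succ' hq (n + 1) k, gaussBinom_succ q n (k - 1),
      show k - 1 - 1 = k - 2 by ring]
    have e : q ^ (((n + 1 : ℕ) : ℤ) + 1 - k) * q ^ (k - 1) = q ^ n * q := by
      rw [← zpow_add₀ hq, ← pow_succ, ← zpow_natCast]; congr 1; push_cast; ring
    rw [show ((n : ℤ) + 2 - k) = ((n + 1 : ℕ) : ℤ) + 1 - k by push_cast; ring]
    linear_combination (-1) ^ j * q ^ (j * (5 * j + 1) / 2) * gaussBinom q n (k - 1) * e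
  · have hc : schurCert q n j = 0 := if_neg (by omega)
    have hd : schurCert q n (j - 1) = _ := if_pos (by omega)
    rw [hc, hd]
    simp only [schurTerm]
    rw [show (((n + 2 : ℕ) : ℤ) - 5 * j) / 2 = k + 1 by push_cast; omega,
      show (((n + 1 : ℕ) : ℤ) - 5 * j) / 2 = k by push_cast; omega,
      show ((n : ℤ) - 5 * j) / 2 = k by omega,
      show ((n : ℤ) + 1 - 5 * (j - 1)) / 2 = k + 3 by omega,
      gaussBinom_succ q (n + 1) (k + 1), gaussBinom_succ' hq n (k + 1),
      show k + 1 - 1 = k by ring, show k + 3 - 2 = k + 1 by ring]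
    have e : q ^ (k + 1) * q ^ ((n : ℤ) + 1 - (k + 1)) = q ^ n * q := by
      rw [← zpow_add₀ hq, ← pow_succ, ← zpow_natCast]; congr 1; push_cast; ring
    have hsign : (-1 : K) ^ j = -(-1) ^ (j - 1) := by
      rw [zpow_sub_one₀ (by simp)]; simp
    have hexp : j * (5 * j + 1) / 2 = (j - 1) * (5 * (j - 1) + 1) / 2 + (5 * j - 2) := by
      rw [show j * (5 * j + 1) = (j - 1) * (5 * (j - 1) + 1) + (5 * j - 2) * 2 by ring,
        Int.add_mul_ediv_right _ _ two_ne_zero]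
    have e2 : q ^ (j * (5 * j + 1) / 2) * q ^ (k + 1) =
        q ^ ((j - 1) * (5 * (j - 1) + 1) / 2) * q ^ ((n : ℤ) + 2 - (k + 3)) := by
      rw [hexp, ← zpow_add₀ hq, ← zpow_add₀ hq]
      congr 1
      omega
    rw [hsign]
    linear_combination -(-1) ^ (j - 1) * q ^ (j * (5 * j + 1) / 2) * gaussBinom q n k * e -
      (-1) ^ (j - 1) * gaussBinom q n (k + 1) * e2

/-- Schur's formula for the `q`-Fibonacci numbers. -/
lemma qRec_eq_sum_schurTerm {q : K} (hq : q ≠ 0) (N n : ℕ) (hn : n ≤ N) :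
    qRec q 1 0 1 (n + 1) = ∑ i ∈ Finset.range (2 * N + 3), schurTerm q n ((i : ℤ) - (N + 1)) := by
  have hbase (n : ℕ) (hn : n ≤ 1) : ∑ i ∈ Finset.range (2 * N + 3),
      schurTerm q n ((i : ℤ) - (N + 1)) = 1 := by
    rw [Finset.sum_eq_single_of_mem (N + 1) (by simp; omega)]
    · have : ((n : ℤ)) / 2 = 0 := by omega
      simp [schurTerm, this, gaussBinom_zero_right]
    · intro i _ hi
      have : gaussBinom q n (((n : ℤ) - 5 * ((i : ℤ) - (N + 1))) / 2) = 0 := by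
        rcases lt_or_gt_of_ne hi with h | h
        · exact gaussBinom_of_lt _ _ (by omega)
        · exact gaussBinom_of_neg _ _ (by omega)
      rw [schurTerm, this, mul_zero]
  induction n using Nat.twoStepInduction with
  | zero => rw [hbase 0 (by omega)]; simp [qRec]
  | one => rw [hbase 1 le_rfl]; simp [qRec]
  | more n h1 h2 =>
    rw [qRec_add_two, h1 (by omega), h2 (by omega), eq_comm, ← sub_eq_zero, ← sub_sub, one_mul,
      Finset.mul_sum, ← Finset.sum_sub_distrib, ← Finset.sum_sub_distrib]
    have htel := Finset.sum_range_sub (fun i : ℕ => schurCert q n ((i : ℤ) - (N + 2)))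
      (2 * N + 3)
    rw [Finset.sum_congr rfl (g := fun i : ℕ => schurCert q n (((i + 1 : ℕ) : ℤ) - (N + 2)) -
      schurCert q n ((i : ℤ) - (N + 2)))]
    · rw [htel]
      have hz (j : ℤ) (hj : j = -(N + 2) ∨ j = N + 1) : schurCert q n j = 0 := by
        rw [schurCert]
        split_ifs
        · rcases hj with rfl | rfl
          · rw [gaussBinom_of_lt _ _ (by omega)]; ring
          · rw [gaussBinom_of_neg _ _ (by omega)]; ring
        · rfl
      rw [hz _ (Or.inr (by push_cast; ring)), hz _ (Or.inl (by push_cast; ring)), sub_zero]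
    · intro i _
      rw [pow_succ, schurTerm_recurrence hq]
      congr 2 <;> push_cast <;> ring

end Schur

section RootOfUnity

variable {K : Type*} [Field K]

lemma neg_one_pow_mul_pow_orderOf_half {q : K} (hq : orderOf q ≠ 0) {m : ℕ}
    (hm : Odd (m + orderOf q)) : (-1) ^ m * q ^ (m * orderOf q / 2) = 1 := by
  rcases Nat.even_or_odd' (orderOf q) with ⟨s, hs | hs⟩
  · have hmo : Odd m := by
      rw [Nat.odd_add] at hm; exact hm.mpr ⟨s, by omega⟩
    have hqs : q ^ s = -1 := by
      have h2 : q ^ s * q ^ s = 1 := by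
        rw [← pow_add, ← two_mul, ← hs, pow_orderOf_eq_one]
      refine (mul_self_eq_one_iff.mp h2).resolve_left fun h1 => ?_
      exact absurd (orderOf_dvd_of_pow_eq_one h1)
        (Nat.not_dvd_of_pos_of_lt (by omega) (by omega))
    rw [show m * orderOf q / 2 = s * m by rw [hs, mul_left_comm, Nat.mul_div_cancel_left _ two_pos,
      mul_comm], pow_mul, hqs, ← mul_pow]
    simp
  · obtain ⟨r, hr⟩ : ∃ r, m = 2 * r := by
      obtain ⟨c, hc⟩ := hm
      exact ⟨m / 2, by omega⟩
    rw [show m * orderOf q / 2 = orderOf q * r by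
      rw [hr, mul_assoc, Nat.mul_div_cancel_left _ two_pos, mul_comm], pow_mul,
      pow_orderOf_eq_one, hr, pow_mul]
    simp

lemma qRec_orderOf_succ_of_mod_five {q : K} (hq : q ≠ 0) (ht : orderOf q ≠ 0)
    (h : orderOf q % 5 = 1 ∨ orderOf q % 5 = 4) : qRec q 1 0 1 (orderOf q + 1) = 1 := by
  set t := orderOf q with htdef
  rw [qRec_eq_sum_schurTerm hq t t le_rfl]
  have hval (i : ℕ) (k : ℤ) (hk : ((t : ℤ) - 5 * ((i : ℤ) - (t + 1))) / 2 = k)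
      (h0 : k ≠ 0) (h1 : k ≠ t) : schurTerm q t ((i : ℤ) - (t + 1)) = 0 := by
    rw [schurTerm, hk, htdef, gaussBinom_orderOf hq h0 h1 ht, mul_zero]
  rcases h with h | h
  · obtain ⟨m, hm⟩ : ∃ m, t = 5 * m + 1 := ⟨t / 5, by omega⟩
    rw [Finset.sum_eq_single_of_mem (t + 1 + m) (by simp; omega)]
    · rw [schurTerm, show ((t + 1 + m : ℕ) : ℤ) - (t + 1) = m by push_cast; ring,
        show ((t : ℤ) - 5 * m) / 2 = 0 by omega, gaussBinom_zero_right, mul_one,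
        show (5 * (m : ℤ) + 1) = t by omega,
        show (m : ℤ) * t / 2 = ((m * t / 2 : ℕ) : ℤ) by push_cast; rfl, zpow_natCast, zpow_natCast]
      exact neg_one_pow_mul_pow_orderOf_half ht (by rw [← htdef, Nat.odd_iff]; omega)
    · intro i _ hi
      exact hval i _ rfl (by omega) (by omega)
  · obtain ⟨m, hm⟩ : ∃ m, t + 1 = 5 * m := ⟨(t + 1) / 5, by omega⟩
    rw [Finset.sum_eq_single_of_mem (t + 1 - m) (by simp; omega)]
    · rw [schurTerm, show ((t + 1 - m : ℕ) : ℤ) - (t + 1) = -m by omega,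
        show ((t : ℤ) - 5 * (-m)) / 2 = t by omega, gaussBinom_self, mul_one,
        show -(m : ℤ) * (5 * (-m) + 1) = m * t by
          rw [show (5 * (-(m : ℤ)) + 1) = -t by omega]; ring,
        show (m : ℤ) * t / 2 = ((m * t / 2 : ℕ) : ℤ) by push_cast; rfl, zpow_natCast,
        zpow_neg, zpow_natCast, ← inv_pow, inv_neg_one]
      exact neg_one_pow_mul_pow_orderOf_half ht (by rw [← htdef, Nat.odd_iff]; omega)
    · intro i _ hi
      exact hval i _ rfl (by omega) (by omega)

lemma qRec_orderOf_succ_of_mod_five' {q : K} (hq : q ≠ 0) (ht : orderOf q ≠ 0)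
    (h : orderOf q % 5 = 2 ∨ orderOf q % 5 = 3) : qRec q 1 0 1 (orderOf q + 1) = 0 := by
  rw [qRec_eq_sum_schurTerm hq _ _ le_rfl]
  refine Finset.sum_eq_zero fun i _ => ?_
  rw [schurTerm, gaussBinom_orderOf hq (by omega) (by omega) ht, mul_zero]

lemma qRec_mul_orderOf_add_two {q : K} (hq : 2 ≤ orderOf q) (i : ℕ) :
    qRec q 1 0 1 ((i + 2) * orderOf q + 1) =
      qRec q 1 0 1 ((i + 1) * orderOf q + 1) + qRec q 1 0 1 (i * orderOf q + 1) := by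
  have htr := qRec_trace_eq_one hq
  have hdet := qRec_casoratian q (orderOf q)
  have hs := neg_one_pow_mul_pow_orderOf_half (q := q) (m := orderOf q - 1) (by omega)
    (by rw [Nat.odd_iff]; omega)
  have hstep (a b : K) (n : ℕ) : qRec q 1 a b (n + orderOf q) =
      qRec q 1 a b (orderOf q + 1) * qRec q 1 0 1 n + qRec q 1 a b (orderOf q) * qRec q 1 1 0 n := by
    rw [qRec_shift, pow_orderOf_eq_one, mul_one, qRec_eq_basis]
  generalize orderOf q = t at *
  have hneg : (-1 : K) ^ t = -(-1) ^ (t - 1) := by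
    obtain ⟨s, rfl⟩ : ∃ s, t = s + 1 := ⟨t - 1, by omega⟩
    simp [pow_succ]
  rw [hneg, mul_comm t, neg_mul, hs] at hdet
  rw [show (i + 2) * t + 1 = (i * t + 1 + t) + t by ring,
    show (i + 1) * t + 1 = i * t + 1 + t by ring, hstep 0 1 (i * t + 1 + t), hstep 0 1 (i * t + 1),
    hstep 1 0 (i * t + 1)]
  linear_combination (qRec q 1 0 1 (t + 1) * qRec q 1 0 1 (i * t + 1) +
    qRec q 1 0 1 t * qRec q 1 1 0 (i * t + 1)) * htr - qRec q 1 0 1 (i * t + 1) * hdet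

lemma eq_fib_of_recurrence {R : Type*} [CommRing R] {u : ℕ → R} (a : ℕ)
    (h0 : u 0 = Nat.fib a) (h1 : u 1 = Nat.fib (a + 1))
    (h : ∀ i, u (i + 2) = u (i + 1) + u i) (i : ℕ) : u i = Nat.fib (i + a) := by
  induction i using Nat.twoStepInduction with
  | zero => simpa using h0
  | one => simpa [add_comm] using h1
  | more n ih1 ih2 =>
    rw [h, ih1, ih2, show n + 2 + a = n + a + 2 by ring, Nat.fib_add_two,
      show n + 1 + a = n + a + 1 by ring]
    push_cast
    ring

end RootOfUnity

section Reduction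

variable {p : ℕ} [Fact p.Prime]

lemma natCast_ne_zero_of_dvd_mul {a b c : ℕ} (h : c ∣ a * b) (ha : (a : ZMod p) ≠ 0)
    (hb : (b : ZMod p) ≠ 0) : (c : ZMod p) ≠ 0 := by
  obtain ⟨d, hd⟩ := h
  intro hc
  have h1 : (a : ZMod p) * b = c * d := by exact_mod_cast congrArg (Nat.cast (R := ZMod p)) hd
  rw [hc, zero_mul] at h1
  exact mul_ne_zero ha hb h1

lemma ratCast_pow_of_den_ne_zero {α : ℚ} (hα : (α.den : ZMod p) ≠ 0) (n : ℕ) :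
    ((α ^ n).den : ZMod p) ≠ 0 ∧ ((α ^ n : ℚ) : ZMod p) = (α : ZMod p) ^ n := by
  induction n with
  | zero => simp
  | succ n ih =>
    rw [pow_succ, pow_succ]
    exact ⟨natCast_ne_zero_of_dvd_mul (Rat.mul_den_dvd _ _) ih.1 hα,
      by rw [Rat.cast_mul_of_ne_zero ih.1 hα, ih.2]⟩

lemma ratCast_qFibQ {α : ℚ} (hα : (α.den : ZMod p) ≠ 0) (n : ℕ) :
    ((qFibQ α n).den : ZMod p) ≠ 0 ∧
      ((qFibQ α n : ℚ) : ZMod p) = qRec (α : ZMod p) 1 0 1 n := by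
  induction n using Nat.twoStepInduction with
  | zero => simp [qFibQ, qRec]
  | one => simp [qFibQ, qRec]
  | more n h1 h2 =>
    have hpow := ratCast_pow_of_den_ne_zero hα n
    have hmul : ((α ^ n * qFibQ α n).den : ZMod p) ≠ 0 :=
      natCast_ne_zero_of_dvd_mul (Rat.mul_den_dvd _ _) hpow.1 h1.1
    rw [qFibQ, qRec_add_two]
    exact ⟨natCast_ne_zero_of_dvd_mul (Rat.add_den_dvd _ _) h2.1 hmul,
      by rw [Rat.cast_add_of_ne_zero h2.1 hmul, Rat.cast_mul_of_ne_zero hpow.1 h1.1, h1.2, h2.2,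
        hpow.2, one_mul]⟩

end Reduction

lemma legendreSym_five (t : ℕ) (ht : ¬ 5 ∣ t) :
    ((t % 5 = 1 ∨ t % 5 = 4) ∧ legendreSym 5 (t : ℤ) = 1) ∨
      ((t % 5 = 2 ∨ t % 5 = 3) ∧ legendreSym 5 (t : ℤ) = -1) := by
  rw [legendreSym.mod]
  have h : t % 5 = 1 ∨ t % 5 = 2 ∨ t % 5 = 3 ∨ t % 5 = 4 := by omega
  rcases h with h | h | h | h
  · rw [show (t : ℤ) % (5 : ℕ) = 1 by omega]; exact Or.inl ⟨by omega, by decide⟩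
  · rw [show (t : ℤ) % (5 : ℕ) = 2 by omega]; exact Or.inr ⟨by omega, by decide⟩
  · rw [show (t : ℤ) % (5 : ℕ) = 3 by omega]; exact Or.inr ⟨by omega, by decide⟩
  · rw [show (t : ℤ) % (5 : ℕ) = 4 by omega]; exact Or.inl ⟨by omega, by decide⟩

/-- For a rational `α = a/b` (in lowest terms) with `α ≠ 0, 1`, and a prime `p` not dividing
`a·b·(a−b)`, if the multiplicative order `t` of `α` mod `p` is not divisible by `5`, then
`F_p(α) ≡ Fib(I + (t/5)) (mod p)` where `I = (p−1)/t` is the residual index and `(t/5)` is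
the Legendre symbol; moreover the index `I + (t/5)` is nonnegative. -/
theorem qFib_congr_fib (α : ℚ) (hα0 : α ≠ 0) (hα1 : α ≠ 1)
    (p : ℕ) [Fact p.Prime]
    (hp : ¬ ((p : ℤ) ∣ α.num * (α.den : ℤ) * (α.num - (α.den : ℤ))))
    (t : ℕ) (ht : t = orderOf ((α : ZMod p)))
    (ht5 : ¬ (5 ∣ t)) :
    0 ≤ ((((p - 1) / t : ℕ) : ℤ) + legendreSym 5 (t : ℤ)) ∧
    ((qFibQ α p : ℚ) : ZMod p) =
      (Nat.fib (((((p - 1) / t : ℕ) : ℤ) + legendreSym 5 (t : ℤ)).toNat) : ZMod p) := by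
  have hden : (α.den : ZMod p) ≠ 0 := fun h => hp <| by
    rw [← ZMod.intCast_zmod_eq_zero_iff_dvd]; push_cast; rw [h]; ring
  have hnum : (α.num : ZMod p) ≠ 0 := fun h => hp <| by
    rw [← ZMod.intCast_zmod_eq_zero_iff_dvd]; push_cast; rw [h]; ring
  have hsub : (α.num : ZMod p) - α.den ≠ 0 := fun h => hp <| by
    rw [← ZMod.intCast_zmod_eq_zero_iff_dvd]; push_cast; rw [h]; ring
  have hcast := (ratCast_qFibQ hden p).2
  have hq0 : (α : ZMod p) ≠ 0 := by
    rw [Rat.cast_def]; exact div_ne_zero hnum hden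
  have hq1 : (α : ZMod p) ≠ 1 := by
    rw [Rat.cast_def, Ne, div_eq_one_iff_eq hden]; exact sub_ne_zero.mp hsub
  rw [hcast]
  generalize (α : ZMod p) = q at *
  have hdvd : t ∣ p - 1 := ht ▸ ZMod.orderOf_dvd_card_sub_one hq0
  have hp2 := (Fact.out : p.Prime).two_le
  have htpos : 0 < t := Nat.pos_of_dvd_of_pos hdvd (by omega)
  have ht2 : 2 ≤ t := by
    have : t ≠ 1 := fun h => hq1 (orderOf_eq_one_iff.mp (ht ▸ h))
    omega
  obtain ⟨m, hm⟩ := hdvd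
  have hmpos : 0 < m := Nat.pos_of_ne_zero (by rintro rfl; omega)
  have hI : (p - 1) / t = m := by rw [hm, Nat.mul_div_cancel_left _ htpos]
  have hpm : p = m * t + 1 := by rw [mul_comm]; omega
  have hrec (i : ℕ) := qRec_mul_orderOf_add_two (q := q) (ht ▸ ht2) i
  rw [hI]
  rcases legendreSym_five t ht5 with ⟨h, hl⟩ | ⟨h, hl⟩
  · rw [hl]
    refine ⟨by omega, ?_⟩
    rw [show ((m : ℤ) + 1).toNat = m + 1 by omega]
    suffices h : qRec q 1 0 1 (m * t + 1) = _ by rwa [← hpm] at h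
    subst ht
    refine eq_fib_of_recurrence (u := fun i => qRec q 1 0 1 (i * orderOf q + 1)) 1 ?_ ?_ hrec m
    · simp [qRec]
    · simpa using qRec_orderOf_succ_of_mod_five hq0 htpos.ne' h
  · rw [hl]
    refine ⟨by omega, ?_⟩
    obtain ⟨s, rfl⟩ : ∃ s, m = s + 1 := ⟨m - 1, by omega⟩
    rw [show (((s + 1 : ℕ) : ℤ) + -1).toNat = s by omega]
    suffices h : qRec q 1 0 1 ((s + 1) * t + 1) = _ by rwa [← hpm] at h
    subst ht
    have hz := qRec_orderOf_succ_of_mod_five' hq0 htpos.ne' h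
    refine eq_fib_of_recurrence (u := fun i => qRec q 1 0 1 ((i + 1) * orderOf q + 1)) 0 ?_ ?_
      (fun i => hrec (i + 1)) s
    · simpa using hz
    · have h0 := hrec 0
      simp only [zero_add, one_mul, zero_mul, hz] at h0
      simpa [qRec] using h0
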